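/- arXiv:1007.2725 — 4 statements merged into one kernel-verified Lean document; each statement's English description precedes it below -/
import Mathlib

section
/- Let P be a finite partially ordered set with n elements and let p, q ∈ ℂ satisfy p + q = 1. For a lower set I of P, let u(I) denote the number of maximal elements of I and v(I) = n − |I|. Then the sum over all lower sets I of P of p^{u(I)} · q^{v(I)} equals 1. (This expresses that, in the sequential growth of causal sets, the transition amplitudes from a fixed n-element causal set to all of its (n+1)-element children sum to 1 when p + q = 1: a new maximal element whose past is the lower set I is linked to the u(I) maximal elements of I and unrelated to the v(I) elements outside I.) -/
open Finset in
/-- The weights of the sets in an interval of the Boolean lattice add up to a monomial. -/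
theorem Finset.sum_Icc_pow_card_mul_pow {α R : Type*} [DecidableEq α] [CommSemiring R]
    {s t : Finset α} (hst : s ⊆ t) {n : ℕ} (hn : #t ≤ n) {p q : R} (hpq : p + q = 1) :
    ∑ A ∈ Icc s t, p ^ #A * q ^ (n - #A) = p ^ #s * q ^ (n - #t) := by
  have hdisj : ∀ A ∈ (t \ s).powerset, Disjoint s A := fun A hA =>
    disjoint_sdiff.mono_right (mem_powerset.1 hA)
  rw [Icc_eq_image_powerset hst, sum_image]
  · calc ∑ A ∈ (t \ s).powerset, p ^ #(s ∪ A) * q ^ (n - #(s ∪ A))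
        = ∑ A ∈ (t \ s).powerset,
            p ^ #s * q ^ (n - #t) * (p ^ #A * q ^ (#(t \ s) - #A)) := by
          refine sum_congr rfl fun A hA => ?_
          have hA' := card_le_card (mem_powerset.1 hA)
          have hs := card_sdiff_add_card_eq_card hst
          rw [card_union_of_disjoint (hdisj A hA),
            show n - (#s + #A) = (n - #t) + (#(t \ s) - #A) by omega, pow_add, pow_add]
          ring
      _ = p ^ #s * q ^ (n - #t) := by
          rw [← mul_sum, sum_pow_mul_eq_add_pow, hpq, one_pow, mul_one]
  · intro A hA B hB h
    rw [← union_sdiff_cancel_left (hdisj A hA), ← union_sdiff_cancel_left (hdisj B hB)]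
    exact congrArg (· \ s) h

open Finset in
/-- The sets generating a given lower set are those between its maximal elements and itself. -/
theorem Finset.filter_exists_le_eq_iff {P : Type*} [PartialOrder P] [Fintype P] [DecidableEq P]
    [DecidableRel ((· ≤ ·) : P → P → Prop)] [DecidableRel ((· < ·) : P → P → Prop)]
    {A I : Finset P} (hI : ∀ x ∈ I, ∀ y : P, y ≤ x → y ∈ I) :
    (univ.filter fun x => ∃ a ∈ A, x ≤ a) = I ↔
      (I.filter fun x => ∀ y ∈ I, ¬ x < y) ⊆ A ∧ A ⊆ I := by
  constructor
  · rintro rfl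
    have hA : A ⊆ univ.filter fun x => ∃ a ∈ A, x ≤ a := fun a ha =>
      mem_filter.2 ⟨mem_univ a, a, ha, le_rfl⟩
    refine ⟨fun x hx => ?_, hA⟩
    obtain ⟨hx, hmax⟩ := mem_filter.1 hx
    obtain ⟨-, a, ha, hxa⟩ := mem_filter.1 hx
    rwa [hxa.eq_of_not_lt (hmax a (hA ha))]
  · rintro ⟨hMA, hAI⟩
    ext x
    simp only [mem_filter, mem_univ, true_and]
    constructor
    · rintro ⟨a, ha, hxa⟩
      exact hI a (hAI ha) x hxa
    · intro hx
      obtain ⟨m, hxm, hm⟩ := I.exists_le_maximal hx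
      exact ⟨m, hMA (mem_filter.2 ⟨hm.prop, fun y hy => hm.not_gt hy⟩), hxm⟩

/-- Let `P` be a finite poset with `n` elements and `p + q = 1` in `ℂ`.
Summing over all lower sets `I` of `P` the quantity `p ^ u(I) * q ^ v(I)`, where `u(I)`
is the number of maximal elements of `I` and `v(I) = n - |I|`, gives `1`. -/
theorem statement6 (P : Type*) [PartialOrder P] [Fintype P] [DecidableEq P]
    [DecidableRel ((· ≤ ·) : P → P → Prop)]
    [DecidableRel ((· < ·) : P → P → Prop)]
    (n : ℕ) (hn : Fintype.card P = n) (p q : ℂ) (hpq : p + q = 1) :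
    ∑ I ∈ Finset.univ.filter (fun I : Finset P => ∀ x ∈ I, ∀ y : P, y ≤ x → y ∈ I),
      p ^ (I.filter (fun x => ∀ y ∈ I, ¬ x < y)).card * q ^ (n - I.card) = 1 := by
  subst hn
  rw [← one_pow (Fintype.card P), ← hpq, ← Fintype.sum_pow_mul_eq_add_pow,
    ← Finset.sum_fiberwise_of_maps_to (s := Finset.univ)
      (g := fun A : Finset P => Finset.univ.filter fun x => ∃ a ∈ A, x ≤ a)
      (t := Finset.univ.filter fun I : Finset P => ∀ x ∈ I, ∀ y : P, y ≤ x → y ∈ I)]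
  · refine Finset.sum_congr rfl fun I hI => ?_
    rw [← Finset.sum_Icc_pow_card_mul_pow (Finset.filter_subset _ _) I.card_le_univ hpq]
    refine Finset.sum_congr ?_ fun _ _ => rfl
    ext A
    simp only [Finset.mem_Icc, Finset.mem_filter_univ,
      Finset.filter_exists_le_eq_iff (Finset.mem_filter.1 hI).2]
  · intro A _
    simp only [Finset.mem_filter_univ]
    rintro x ⟨a, ha, hxa⟩ y hyx
    exact ⟨a, ha, hyx.trans hxa⟩
end

section
/- For every n ≥ 0 and all p, q ∈ ℂ with p + q = 1, the sum over all labelled causal sets ≺ on n elements of the transitive-percolation amplitude p^{L(≺)} · q^{n(n−1)/2 − R(≺)} equals 1, where L(≺) is the number of links and R(≺) the number of relations of ≺. -/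
/-- A labelled causal set on `n` elements: a strict partial order (irreflexive and
transitive relation) on `Fin n`, encoded as a boolean relation, compatible with the
labelling (`x ≺ y → x < y`). -/
def LabelledCauset (n : ℕ) : Type :=
  {r : Fin n → Fin n → Bool //
    (∀ x, ¬ r x x) ∧ (∀ x y z, r x y → r y z → r x z) ∧ (∀ x y, r x y → x < y)}

noncomputable instance (n : ℕ) : Fintype (LabelledCauset n) := by
  unfold LabelledCauset; exact Subtype.fintype _

/-- The number of relations `R(≺)`: pairs `(x, y)` with `x ≺ y`. -/
def numRelations {n : ℕ} (c : LabelledCauset n) : ℕ :=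
  (Finset.univ.filter (fun xy : Fin n × Fin n => c.1 xy.1 xy.2)).card

/-- The number of links `L(≺)`: covering pairs `x ≺ y` with no `z` between them. -/
def numLinks {n : ℕ} (c : LabelledCauset n) : ℕ :=
  (Finset.univ.filter
    (fun xy : Fin n × Fin n => c.1 xy.1 xy.2 ∧ ∀ z, ¬ (c.1 xy.1 z ∧ c.1 z xy.2))).card

theorem Finset.sum_Icc_pow_card_mul_pow_of_add_eq_one {α R : Type*} [DecidableEq α]
    [CommSemiring R] {p q : R} (hpq : p + q = 1) {s t u : Finset α} (hst : s ⊆ t) (htu : t ⊆ u) :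
    ∑ v ∈ Finset.Icc s t, p ^ v.card * q ^ (u.card - v.card) =
      p ^ s.card * q ^ (u.card - t.card) := by
  have hdisj : ∀ w ∈ (t \ s).powerset, Disjoint s w := fun w hw =>
    Finset.disjoint_of_subset_right (Finset.mem_powerset.1 hw) Finset.disjoint_sdiff
  rw [Finset.Icc_eq_image_powerset hst, Finset.sum_image]
  · have key : ∀ w ∈ (t \ s).powerset, p ^ (s ∪ w).card * q ^ (u.card - (s ∪ w).card) =
        p ^ s.card * q ^ (u.card - t.card) * (p ^ w.card * q ^ ((t \ s).card - w.card)) := by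
      intro w hw
      have h1 := Finset.card_union_of_disjoint (hdisj w hw)
      have h2 := Finset.card_le_card (Finset.mem_powerset.1 hw)
      have h3 := Finset.card_sdiff_add_card_eq_card hst
      have h4 := Finset.card_le_card htu
      have h5 : u.card - (s ∪ w).card = (u.card - t.card) + ((t \ s).card - w.card) := by omega
      rw [h5, h1, pow_add, pow_add]
      ring
    rw [Finset.sum_congr rfl key, ← Finset.mul_sum, Finset.sum_pow_mul_eq_add_pow, hpq, one_pow,
      mul_one]
  · intro a ha b hb hab
    have := congrArg (· \ s) hab
    simpa [Finset.union_sdiff_cancel_left (hdisj a ha),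
      Finset.union_sdiff_cancel_left (hdisj b hb)] using this

theorem Fin.card_filter_fst_lt_snd (n : ℕ) :
    (Finset.univ.filter (fun xy : Fin n × Fin n => xy.1 < xy.2)).card = n * (n - 1) / 2 := by
  rw [← Finset.sum_range_id, ← Fin.sum_univ_eq_sum_range (fun i => i), Finset.card_filter,
    Fintype.sum_prod_type_right]
  refine Finset.sum_congr rfl fun y _ => ?_
  rw [← Finset.card_filter, Finset.filter_gt_eq_Iio, Fin.card_Iio]

namespace LabelledCauset

variable {n : ℕ}

/-- The relations of a labelled causal set. -/
def relations (c : LabelledCauset n) : Finset (Fin n × Fin n) :=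
  Finset.univ.filter (fun xy => c.1 xy.1 xy.2)

/-- The links of a labelled causal set. -/
def links (c : LabelledCauset n) : Finset (Fin n × Fin n) :=
  Finset.univ.filter (fun xy => c.1 xy.1 xy.2 ∧ ∀ z, ¬ (c.1 xy.1 z ∧ c.1 z xy.2))

theorem links_subset_relations (c : LabelledCauset n) : c.links ⊆ c.relations :=
  Finset.monotone_filter_right _ fun _ _ h => h.1

theorem relations_subset (c : LabelledCauset n) :
    c.relations ⊆ Finset.univ.filter (fun xy : Fin n × Fin n => xy.1 < xy.2) :=
  Finset.monotone_filter_right _ fun _ _ h => c.2.2.2 _ _ h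

/-- The increasing pairs of `S`, viewed as the edges of a directed graph. -/
def IncreasingEdge (S : Finset (Fin n × Fin n)) (x y : Fin n) : Prop :=
  (x, y) ∈ S ∧ x < y

theorem lt_of_transGen {S : Finset (Fin n × Fin n)} {x y : Fin n}
    (h : Relation.TransGen (IncreasingEdge S) x y) : x < y := by
  induction h with
  | single h => exact h.2
  | tail _ h ih => exact ih.trans h.2

open Classical in
/-- The labelled causal set generated by the increasing pairs of `S`. -/
noncomputable def transClosure (S : Finset (Fin n × Fin n)) : LabelledCauset n :=
  ⟨fun x y => decide (Relation.TransGen (IncreasingEdge S) x y),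
    fun x h => lt_irrefl x (lt_of_transGen (of_decide_eq_true h)),
    fun _ _ _ h₁ h₂ => decide_eq_true ((of_decide_eq_true h₁).trans (of_decide_eq_true h₂)),
    fun _ _ h => lt_of_transGen (of_decide_eq_true h)⟩

theorem transClosure_apply {S : Finset (Fin n × Fin n)} {x y : Fin n} :
    (transClosure S).1 x y ↔ Relation.TransGen (IncreasingEdge S) x y := by
  simp [transClosure]

theorem transGen_of_links_subset {c : LabelledCauset n} {S : Finset (Fin n × Fin n)}
    (hS : c.links ⊆ S) (x y : Fin n) (h : c.1 x y) :
    Relation.TransGen (IncreasingEdge S) x y := by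
  by_cases hl : ∃ z, c.1 x z ∧ c.1 z y
  · obtain ⟨z, hxz, hzy⟩ := hl
    have h₁ : x < z := c.2.2.2 _ _ hxz
    have h₂ : z < y := c.2.2.2 _ _ hzy
    exact (transGen_of_links_subset hS x z hxz).trans (transGen_of_links_subset hS z y hzy)
  · refine .single ⟨hS ?_, c.2.2.2 _ _ h⟩
    simpa [links, h] using hl
termination_by y.val - x.val

theorem transClosure_eq_iff {c : LabelledCauset n} {S : Finset (Fin n × Fin n)}
    (hS : S ⊆ Finset.univ.filter (fun xy : Fin n × Fin n => xy.1 < xy.2)) :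
    transClosure S = c ↔ S ∈ Finset.Icc c.links c.relations := by
  rw [Finset.mem_Icc]
  constructor
  · rintro rfl
    refine ⟨fun ⟨x, y⟩ h => ?_, fun ⟨x, y⟩ h => ?_⟩
    · simp only [links, Finset.mem_filter, Finset.mem_univ, true_and, transClosure_apply] at h
      obtain ⟨h, hl⟩ := h
      cases h with
      | single h => exact h.1
      | tail h₁ h₂ => exact absurd ⟨h₁, .single h₂⟩ (hl _)
    · simp only [relations, Finset.mem_filter, Finset.mem_univ, true_and, transClosure_apply]
      exact .single ⟨h, (Finset.mem_filter.1 (hS h)).2⟩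
  · rintro ⟨hl, hr⟩
    refine Subtype.ext (funext fun x => funext fun y => Bool.eq_iff_iff.2 ?_)
    rw [transClosure_apply]
    refine ⟨fun h => ?_, transGen_of_links_subset hl x y⟩
    induction h with
    | single h => exact (Finset.mem_filter.1 (hr h.1)).2
    | tail _ h ih => exact c.2.2.1 _ _ _ ih (Finset.mem_filter.1 (hr h.1)).2

end LabelledCauset

theorem statement7 (n : ℕ) (p q : ℂ) (hpq : p + q = 1) :
    ∑ c : LabelledCauset n,
      p ^ numLinks c * q ^ (n * (n - 1) / 2 - numRelations c) = 1 := by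
  classical
  set P := Finset.univ.filter (fun xy : Fin n × Fin n => xy.1 < xy.2)
  have hfiber : ∀ c : LabelledCauset n,
      P.powerset.filter (fun S => LabelledCauset.transClosure S = c) =
        Finset.Icc c.links c.relations := by
    intro c
    ext S
    rw [Finset.mem_filter, Finset.mem_powerset]
    refine ⟨fun h => (LabelledCauset.transClosure_eq_iff h.1).1 h.2, fun h => ?_⟩
    have hS : S ⊆ P := (Finset.mem_Icc.1 h).2.trans c.relations_subset
    exact ⟨hS, (LabelledCauset.transClosure_eq_iff hS).2 h⟩
  calc ∑ c : LabelledCauset n, p ^ numLinks c * q ^ (n * (n - 1) / 2 - numRelations c)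
      = ∑ c : LabelledCauset n,
          ∑ S ∈ P.powerset.filter (fun S => LabelledCauset.transClosure S = c),
            p ^ S.card * q ^ (P.card - S.card) := by
        refine Finset.sum_congr rfl fun c _ => ?_
        rw [hfiber, Finset.sum_Icc_pow_card_mul_pow_of_add_eq_one hpq c.links_subset_relations
          c.relations_subset, Fin.card_filter_fst_lt_snd]
        rfl
    _ = ∑ S ∈ P.powerset, p ^ S.card * q ^ (P.card - S.card) :=
        Finset.sum_fiberwise _ _ _
    _ = 1 := by rw [Finset.sum_pow_mul_eq_add_pow, hpq, one_pow]
end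

section
/- Let N ≥ 2, let Ω = (Fin N)^ℕ with cylinder algebra 𝒜, let H be a complex Hilbert space, and let μ : 𝒜 → H be finitely additive with ‖μ(Ω)‖ = 1. Suppose that every α ∈ 𝒜 with α ≠ Ω is contained in some β ∈ 𝒜 with μ(β) = 0 (i.e. every proper event is contained in a set of quantum measure zero). Then μ is not of bounded variation: for every n ≥ 1 there is a finite 𝒜-partition of Ω on which the sum of the norms of μ is at least Nⁿ. Equivalently, if μ is of bounded variation, then not every proper event in 𝒜 can be contained in a set of measure zero. -/
/-- The cylinder set of a finite string `γ` of length `m`: all infinite histories whose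
first `m` entries agree with `γ`. -/
def cylSet {N m : ℕ} (γ : Fin m → Fin N) : Set (ℕ → Fin N) :=
  {x | ∀ i : Fin m, x i = γ i}

/-- The cylinder algebra over `Ω = (Fin N)^ℕ`: all finite unions of cylinder sets. -/
def cylAlgebra (N : ℕ) : Set (Set (ℕ → Fin N)) :=
  {s | ∃ (k : ℕ) (m : Fin k → ℕ) (γ : ∀ i : Fin k, Fin (m i) → Fin N),
    s = ⋃ i, cylSet (γ i)}

/-- `μ` is finitely additive on the members of `𝒜`. -/
def FinitelyAdditiveOn {Ω M : Type*} [AddCommMonoid M]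
    (𝒜 : Set (Set Ω)) (μ : Set Ω → M) : Prop :=
  ∀ α ∈ 𝒜, ∀ β ∈ 𝒜, Disjoint α β → μ (α ∪ β) = μ α + μ β

/-- A set of histories belongs to the cylinder algebra iff membership is decided by
finitely many initial entries. -/
theorem mem_cylAlgebra_iff {N : ℕ} {s : Set (ℕ → Fin N)} :
    s ∈ cylAlgebra N ↔
      ∃ m : ℕ, ∀ x y : ℕ → Fin N, (∀ i < m, x i = y i) → x ∈ s → y ∈ s := by
  constructor
  · rintro ⟨k, m, γ, rfl⟩
    refine ⟨Finset.univ.sup m, fun x y hxy hx => ?_⟩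
    obtain ⟨i, hi⟩ := Set.mem_iUnion.1 hx
    refine Set.mem_iUnion.2 ⟨i, fun j => ?_⟩
    rw [← hxy j (j.2.trans_le (Finset.le_sup (f := m) (Finset.mem_univ i)))]
    exact hi j
  · rintro ⟨m, hm⟩
    let T : Set (Fin m → Fin N) := {γ | cylSet γ ⊆ s}
    obtain ⟨k, ⟨e⟩⟩ := Finite.exists_equiv_fin T
    refine ⟨k, fun _ => m, fun i => (e.symm i).1, Set.Subset.antisymm (fun x hx => ?_) ?_⟩
    · have hT : (fun i : Fin m => x i) ∈ T := fun y hy =>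
        hm x y (fun i hi => (hy ⟨i, hi⟩).symm) hx
      refine Set.mem_iUnion.2 ⟨e ⟨_, hT⟩, fun i => ?_⟩
      simp
    · exact Set.iUnion_subset fun i => (e.symm i).2

theorem cylSet_mem_cylAlgebra {N m : ℕ} (γ : Fin m → Fin N) : cylSet γ ∈ cylAlgebra N :=
  mem_cylAlgebra_iff.2 ⟨m, fun _ _ hxy hx i => (hxy i i.2).symm.trans (hx i)⟩

theorem compl_mem_cylAlgebra {N : ℕ} {s : Set (ℕ → Fin N)} (hs : s ∈ cylAlgebra N) :
    sᶜ ∈ cylAlgebra N := by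
  obtain ⟨m, hm⟩ := mem_cylAlgebra_iff.1 hs
  exact mem_cylAlgebra_iff.2 ⟨m, fun x y hxy hx hy =>
    hx (hm y x (fun i hi => (hxy i hi).symm) hy)⟩

theorem iUnion_mem_cylAlgebra {N : ℕ} {ι : Type*} [Fintype ι] {s : ι → Set (ℕ → Fin N)}
    (hs : ∀ i, s i ∈ cylAlgebra N) : (⋃ i, s i) ∈ cylAlgebra N := by
  choose m hm using fun i => mem_cylAlgebra_iff.1 (hs i)
  refine mem_cylAlgebra_iff.2 ⟨Finset.univ.sup m, fun x y hxy hx => ?_⟩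
  obtain ⟨i, hi⟩ := Set.mem_iUnion.1 hx
  exact Set.mem_iUnion.2 ⟨i, hm i x y (fun j hj =>
    hxy j (hj.trans_le (Finset.le_sup (f := m) (Finset.mem_univ i)))) hi⟩

theorem cylSet_nonempty {N m : ℕ} (hN : 0 < N) (γ : Fin m → Fin N) : (cylSet γ).Nonempty :=
  ⟨fun i => if h : i < m then γ ⟨i, h⟩ else ⟨0, hN⟩, fun i => by simp⟩

theorem pairwise_disjoint_cylSet (N m : ℕ) :
    Pairwise (Function.onFun Disjoint (cylSet : (Fin m → Fin N) → Set (ℕ → Fin N))) :=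
  fun _ _ hne => Set.disjoint_left.2 fun _ h₁ h₂ =>
    hne (funext fun i => (h₁ i).symm.trans (h₂ i))


/-- Let `N ≥ 2`, let `μ` be a finitely additive function from the
cylinder algebra over `Ω = (Fin N)^ℕ` to a complex Hilbert space `H` with `‖μ Ω‖ = 1`.
If every `α` in the algebra other than `Ω` is contained in some `β` in the algebra of
quantum measure zero (`μ β = 0`), then `μ` is not of bounded variation: for every
`n ≥ 1` there is a finite partition of `Ω` into members of the algebra on which the
norms of `μ` sum to at least `N ^ n`. -/
theorem statement12 (N : ℕ) (hN : 2 ≤ N) (H : Type*)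
    [NormedAddCommGroup H] [InnerProductSpace ℂ H] [CompleteSpace H]
    (μ : Set (ℕ → Fin N) → H)
    (hadd : FinitelyAdditiveOn (cylAlgebra N) μ)
    (hΩ : ‖μ Set.univ‖ = 1)
    (hzero : ∀ α ∈ cylAlgebra N, α ≠ Set.univ →
      ∃ β ∈ cylAlgebra N, α ⊆ β ∧ μ β = 0) :
    ∀ n : ℕ, 1 ≤ n → ∃ (k : ℕ) (f : Fin k → Set (ℕ → Fin N)),
      (∀ i, f i ∈ cylAlgebra N) ∧ Pairwise (Function.onFun Disjoint f) ∧
        (⋃ i, f i) = Set.univ ∧ (N : ℝ) ^ n ≤ ∑ i, ‖μ (f i)‖ := by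
  intro n _
  have hsub : ∀ γ : Fin n → Fin N, ∃ δ ∈ cylAlgebra N, δ ⊆ cylSet γ ∧ ‖μ δ‖ = 1 := by
    intro γ
    obtain ⟨β, hβ, hγβ, hμβ⟩ := hzero (cylSet γ)ᶜ
      (compl_mem_cylAlgebra (cylSet_mem_cylAlgebra γ))
      (fun h => (cylSet_nonempty (by omega) γ).ne_empty (Set.compl_univ_iff.1 h))
    refine ⟨βᶜ, compl_mem_cylAlgebra hβ, Set.compl_subset_comm.1 hγβ, ?_⟩
    have h := hadd β hβ βᶜ (compl_mem_cylAlgebra hβ) disjoint_compl_right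
    rw [Set.union_compl_self, hμβ, zero_add] at h
    rw [← h, hΩ]
  choose δ hδ hδγ hμδ using hsub
  let g : Option (Fin n → Fin N) → Set (ℕ → Fin N) := fun o => o.elim (⋃ γ, δ γ)ᶜ δ
  have hdisj : Pairwise (Function.onFun Disjoint g) := by
    rintro (_ | a) (_ | b) hab
    · exact absurd rfl hab
    · exact Set.disjoint_compl_left_iff_subset.2 (Set.subset_iUnion δ b)
    · exact Set.disjoint_compl_right_iff_subset.2 (Set.subset_iUnion δ a)
    · exact (pairwise_disjoint_cylSet N n fun h => hab (congrArg some h)).mono (hδγ a) (hδγ b)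
  let e := Fintype.equivFin (Option (Fin n → Fin N))
  refine ⟨_, g ∘ e.symm, fun i => ?_, fun i j hij => hdisj (e.symm.injective.ne hij), ?_, ?_⟩
  · rcases h : e.symm i with _ | γ <;> simp only [Function.comp_apply, h]
    · exact compl_mem_cylAlgebra (iUnion_mem_cylAlgebra hδ)
    · exact hδ γ
  · rw [show (⋃ i, (g ∘ e.symm) i) = ⋃ o, g o from e.symm.surjective.iUnion_comp g,
      Set.iUnion_option]
    exact Set.compl_union_self _
  · rw [show (∑ i, ‖μ ((g ∘ e.symm) i)‖) = ∑ o, ‖μ (g o)‖ from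
      e.symm.sum_comp fun o => ‖μ (g o)‖, Fintype.sum_option]
    simp [g, hμδ]
end

section
/- Let U = (1/√2)·[[1, i],[i, 1]] and, for m ≥ 1 and a string γ : {0,…,m−1} → {0,1}, let C_γ = P_{γ(m−1)} U P_{γ(m−2)} U ⋯ U P_{γ(0)} be the associated class operator. Then: if γ(0) = 1 then C_γ e₀ = 0, and if γ(0) = 0 then C_γ e₀ = (1/√2)^{m−1} · i^{f(γ)} · e_{γ(m−1)}, where f(γ) = #{r ∈ {0,…,m−2} : γ(r+1) ≠ γ(r)} is the number of flips of γ. -/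
open Matrix

/-- The single-step unitary `U = (1/√2)·[[1, i],[i, 1]]`. -/
noncomputable def Umat : Matrix (Fin 2) (Fin 2) ℂ :=
  ((Real.sqrt 2 : ℂ))⁻¹ • !![1, Complex.I; Complex.I, 1]

/-- The projections `P₀, P₁` onto the standard basis vectors of `ℂ²`. -/
def Pmat : Fin 2 → Matrix (Fin 2) (Fin 2) ℂ :=
  fun s => if s = 0 then !![1, 0; 0, 0] else !![0, 0; 0, 1]

/-- The class operator `C_γ = P_{γ(m-1)} U P_{γ(m-2)} U ⋯ U P_{γ(0)}` of a binary
string `γ` of length `m + 1`. -/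
noncomputable def classOp : {m : ℕ} → (Fin (m + 1) → Fin 2) → Matrix (Fin 2) (Fin 2) ℂ
  | 0, γ => Pmat (γ 0)
  | (m + 1), γ =>
      Pmat (γ (Fin.last (m + 1))) * Umat * classOp (fun i : Fin (m + 1) => γ i.castSucc)

/-- The number of flips of a binary string `γ` of length `m + 1`: the number of indices
`r ≤ m - 1` with `γ (r+1) ≠ γ r`. -/
def flips {m : ℕ} (γ : Fin (m + 1) → Fin 2) : ℕ :=
  (Finset.univ.filter (fun r : Fin m => γ r.succ ≠ γ r.castSucc)).card

/-- The standard basis vector `e₀ = (1, 0)` of `ℂ²`. -/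
def e0 : Fin 2 → ℂ := ![1, 0]

lemma flips_succ {m : ℕ} (γ : Fin (m + 2) → Fin 2) :
    flips γ = flips (fun i : Fin (m + 1) => γ i.castSucc) +
      if γ (Fin.last (m + 1)) ≠ γ (Fin.last m).castSucc then 1 else 0 := by
  simp only [flips, Finset.card_filter, Fin.sum_univ_castSucc, Fin.succ_castSucc, Fin.succ_last]

lemma Pmat_mul_Umat_mulVec_single (s t : Fin 2) :
    (Pmat t * Umat).mulVec (Pi.single s 1) =
      ((Real.sqrt 2 : ℂ)⁻¹ * Complex.I ^ (if t ≠ s then 1 else 0)) •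
        (Pi.single t 1 : Fin 2 → ℂ) := by
  ext i
  fin_cases s <;> fin_cases t <;> fin_cases i <;> simp [Pmat, Umat]

/-- For every string `γ` of length `m + 1` (`m ≥ 0`): if `γ 0 = 1`
then `C_γ e₀ = 0`, and if `γ 0 = 0` then
`C_γ e₀ = (1/√2)^m · i^{f(γ)} · e_{γ(m)}` where `f(γ)` is the number of flips. -/
theorem statement13 (m : ℕ) (γ : Fin (m + 1) → Fin 2) :
    (γ 0 = 1 → (classOp γ).mulVec e0 = 0) ∧
      (γ 0 = 0 → (classOp γ).mulVec e0 =
        (((Real.sqrt 2 : ℂ))⁻¹ ^ m * Complex.I ^ flips γ) •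
          (Pi.single (γ (Fin.last m)) 1 : Fin 2 → ℂ)) := by
  induction m with
  | zero =>
    constructor <;> intro h <;> ext i <;> fin_cases i <;>
      simp [classOp, Pmat, h, e0, flips, Matrix.mulVec, dotProduct]
  | succ m ih =>
    obtain ⟨ih₁, ih₀⟩ := ih fun i => γ i.castSucc
    simp only [classOp, ← Matrix.mulVec_mulVec _ (_ * _)]
    refine ⟨fun h => ?_, fun h => ?_⟩
    · rw [ih₁ h, Matrix.mulVec_zero]
    · rw [ih₀ h, Matrix.mulVec_smul, Pmat_mul_Umat_mulVec_single, smul_smul, flips_succ]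
      congr 1
      ring
end
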